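/- arXiv:1404.7704 — 2 statements merged into one kernel-verified Lean document; each statement's English description precedes it below -/
import Mathlib

section
/- Let d ≥ 3 and let f₀ ∈ ℂ[x,y] be a product of d pairwise non-proportional linear forms with first factor L₁ = x, so f₀ = x·h where h(x,y) = ∏_{i=2}^{d}(y - bᵢx) with pairwise distinct bᵢ and h(0,y) = α y^{d-1} + (lower order in y is absent), α ≠ 0. For s ≠ 0 set f_s = s·x^{d-1} + f₀. Then the Milnor number of f_s at 0 equals (d-1)(d-2) + 1. -/
open MvPolynomial

noncomputable section Milnor

abbrev RR := MvPowerSeries (Fin 2) ℂ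

lemma coe_sub_RR (p q : MvPolynomial (Fin 2) ℂ) : ((p - q : MvPolynomial (Fin 2) ℂ) : RR) = p - q :=
  map_sub (MvPolynomial.coeToMvPowerSeries.ringHom (σ := Fin 2) (R := ℂ)) p q

def EE (i j : ℕ) : Fin 2 →₀ ℕ := Finsupp.single 0 i + Finsupp.single 1 j

lemma EE_zero (i j : ℕ) : EE i j 0 = i := by simp [EE]
lemma EE_one (i j : ℕ) : EE i j 1 = j := by simp [EE]
lemma EE_eta (d : Fin 2 →₀ ℕ) : EE (d 0) (d 1) = d := by
  ext k; fin_cases k <;> simp [EE]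

lemma hasSubst_line (u v : ℂ) :
    MvPowerSeries.HasSubst
      (![PowerSeries.C u * PowerSeries.X, PowerSeries.C v * PowerSeries.X] :
        Fin 2 → MvPowerSeries Unit ℂ) := by
  apply MvPowerSeries.hasSubst_of_constantCoeff_zero
  intro k
  have : ∀ w : ℂ, PowerSeries.constantCoeff (PowerSeries.C w * PowerSeries.X) = 0 := by
    intro w; simp
  fin_cases k
  · exact this u
  · exact this v

def phi (u v : ℂ) : RR →ₐ[ℂ] PowerSeries ℂ :=
  MvPowerSeries.substAlgHom (hasSubst_line u v)

lemma phi_coe (u v : ℂ) (p : MvPolynomial (Fin 2) ℂ) :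
    phi u v (p : RR) = MvPolynomial.aeval
      (![PowerSeries.C u * PowerSeries.X, PowerSeries.C v * PowerSeries.X] :
        Fin 2 → PowerSeries ℂ) p :=
  MvPowerSeries.substAlgHom_coe _ p

lemma coeff_phi (u v : ℂ) (f : RR) (n : ℕ) :
    PowerSeries.coeff n (phi u v f) =
      ∑ p ∈ Finset.HasAntidiagonal.antidiagonal n, MvPowerSeries.coeff (EE p.1 p.2) f * (u ^ p.1 * v ^ p.2) := by
  have h0 : PowerSeries.coeff n (phi u v f) = _ :=
    (congrArg (fun g => MvPowerSeries.coeff (Finsupp.single () n) g)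
      (MvPowerSeries.substAlgHom_apply (hasSubst_line u v) f)).trans
    (MvPowerSeries.coeff_subst (hasSubst_line u v) f (Finsupp.single () n))
  have key : ∀ d : Fin 2 →₀ ℕ, MvPowerSeries.coeff (Finsupp.single () n)
      (d.prod fun s e => (![PowerSeries.C u * PowerSeries.X, PowerSeries.C v * PowerSeries.X] s :
        MvPowerSeries Unit ℂ) ^ e) = if n = d 0 + d 1 then u ^ d 0 * v ^ d 1 else 0 := by
    intro d
    rw [Finsupp.prod_fintype _ _ (by simp), Fin.prod_univ_two]
    change PowerSeries.coeff n ((PowerSeries.C u * PowerSeries.X) ^ d 0 *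
      (PowerSeries.C v * PowerSeries.X) ^ d 1) = _
    rw [show (PowerSeries.C u * PowerSeries.X) ^ d 0 * (PowerSeries.C v * PowerSeries.X) ^ d 1
      = PowerSeries.C (u ^ d 0 * v ^ d 1) * PowerSeries.X ^ (d 0 + d 1) by
        simp only [map_mul, map_pow]; ring]
    rw [PowerSeries.coeff_C_mul, PowerSeries.coeff_X_pow]
    split_ifs <;> simp
  rw [h0]
  simp only [key]
  rw [finsum_eq_sum_of_support_subset (s := (Finset.HasAntidiagonal.antidiagonal n).image fun p => EE p.1 p.2)]
  · rw [Finset.sum_image]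
    · apply Finset.sum_congr rfl
      intro p hp
      rw [Finset.HasAntidiagonal.mem_antidiagonal] at hp
      simp [EE_zero, EE_one, hp]
    · intro p _ q _ h
      have h1 := DFunLike.congr_fun h 0
      have h2 := DFunLike.congr_fun h 1
      simp only [EE_zero, EE_one] at h1 h2
      exact Prod.ext h1 h2
  · intro d hd
    simp only [Function.mem_support] at hd
    have : n = d 0 + d 1 := by
      by_contra h
      simp [h] at hd
    simp only [Finset.coe_image, Set.mem_image, Finset.mem_coe, Finset.HasAntidiagonal.mem_antidiagonal]
    exact ⟨(d 0, d 1), this.symm, EE_eta d⟩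

/-- `φ` exhibits the line `ℓ = 0` as a smooth branch. -/
structure IsLine (l : RR) (φ : RR →ₐ[ℂ] PowerSeries ℂ) : Prop where
  surj : Function.Surjective φ
  ker : ∀ f, φ f = 0 ↔ l ∣ f

lemma isLine_x : IsLine (MvPowerSeries.X 0) (phi 0 1) := by
  have hc : ∀ f n, PowerSeries.coeff n (phi 0 1 f) = MvPowerSeries.coeff (EE 0 n) f := by
    intro f n
    rw [coeff_phi, Finset.sum_eq_single (0, n)]
    · simp
    · rintro ⟨i, j⟩ h hne
      have : i ≠ 0 := by
        rintro rfl
        simp at h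
        exact hne (by simp [h])
      simp [this]
    · simp
  constructor
  · intro p
    let F : RR := fun d => PowerSeries.coeff (d 1) p
    refine ⟨F, ?_⟩
    ext n
    rw [hc]
    change PowerSeries.coeff (EE 0 n 1) p = _
    rw [EE_one]
  · intro f
    rw [MvPowerSeries.X_dvd_iff, PowerSeries.ext_iff]
    simp only [hc, map_zero]
    constructor
    · intro h d hd
      rw [← EE_eta d, hd]; exact h _
    · intro h n
      exact h _ (EE_zero _ _)

lemma coeff_line_mul (c : ℂ) (g : RR) (i j : ℕ) :
    MvPowerSeries.coeff (EE i j) ((MvPowerSeries.X 1 - MvPowerSeries.C c * MvPowerSeries.X 0) * g)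
      = (if 1 ≤ j then MvPowerSeries.coeff (EE i (j-1)) g else 0)
        - c * (if 1 ≤ i then MvPowerSeries.coeff (EE (i-1) j) g else 0) := by
  rw [sub_mul, map_sub, mul_assoc, MvPowerSeries.coeff_C_mul, MvPowerSeries.X, MvPowerSeries.X,
    MvPowerSeries.coeff_monomial_mul, MvPowerSeries.coeff_monomial_mul]
  have a1 : (Finsupp.single (1 : Fin 2) 1 ≤ EE i j) ↔ 1 ≤ j := by
    simp [EE_one]
  have a0 : (Finsupp.single (0 : Fin 2) 1 ≤ EE i j) ↔ 1 ≤ i := by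
    simp [EE_zero]
  have b1 : EE i j - Finsupp.single (1 : Fin 2) 1 = EE i (j-1) := by
    ext k; fin_cases k <;> simp [EE]
  have b0 : EE i j - Finsupp.single (0 : Fin 2) 1 = EE (i-1) j := by
    ext k; fin_cases k <;> simp [EE]
  simp only [a0, a1, b0, b1, one_mul]

lemma isLine_c (c : ℂ) :
    IsLine (MvPowerSeries.X 1 - MvPowerSeries.C c * MvPowerSeries.X 0) (phi 1 c) := by
  have hc : ∀ f n, PowerSeries.coeff n (phi 1 c f) =
      ∑ k ∈ Finset.range (n+1), MvPowerSeries.coeff (EE (n-k) k) f * c ^ k := by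
    intro f n
    rw [coeff_phi, ← Finset.Nat.sum_antidiagonal_swap,
      Finset.Nat.sum_antidiagonal_eq_sum_range_succ_mk]
    simp
  constructor
  · intro p
    let F : RR := fun d => if d 1 = 0 then PowerSeries.coeff (d 0) p else 0
    refine ⟨F, ?_⟩
    ext n
    rw [hc, Finset.sum_eq_single 0]
    · change (if EE (n-0) 0 1 = 0 then PowerSeries.coeff (EE (n-0) 0 0) p else 0) * _ = _
      simp [EE_one, EE_zero]
    · intro k _ hk
      change (if EE (n-k) k 1 = 0 then PowerSeries.coeff (EE (n-k) k 0) p else 0) * _ = _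
      simp [EE_one, hk]
    · simp
  · intro f
    constructor
    · intro h
      let g : RR := fun d => ∑ k ∈ Finset.range (d 0 + 1),
        c ^ k * MvPowerSeries.coeff (EE (d 0 - k) (d 1 + 1 + k)) f
      have hg : ∀ i j, MvPowerSeries.coeff (EE i j) g = ∑ k ∈ Finset.range (i + 1),
        c ^ k * MvPowerSeries.coeff (EE (i - k) (j + 1 + k)) f := by
        intro i j
        change ∑ k ∈ Finset.range (EE i j 0 + 1),
          c ^ k * MvPowerSeries.coeff (EE (EE i j 0 - k) (EE i j 1 + 1 + k)) f = _
        rw [EE_zero, EE_one]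
      refine ⟨g, ?_⟩
      ext d
      rw [← EE_eta d, coeff_line_mul]
      generalize d 0 = i
      generalize d 1 = j
      rcases j with _ | j
      · have h1 := congrArg (PowerSeries.coeff i) h
        rw [hc, map_zero, Finset.sum_range_succ'] at h1
        rcases i with _ | i
        · simpa using h1
        · simp only [hg]
          simp only [Nat.add_sub_cancel]
          simp at h1 ⊢
          rw [eq_neg_of_add_eq_zero_right h1]
          rw [Finset.mul_sum]
          congr 1
          apply Finset.sum_congr rfl
          intro k _
          rw [show 1 + k = k + 1 by ring]; ring
      · rcases i with _ | i
        · simp [hg]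
        · simp only [hg]
          simp only [Nat.add_sub_cancel]
          rw [Finset.sum_range_succ']
          simp [Finset.mul_sum]
          rw [eq_comm, add_sub_right_comm, add_eq_right, sub_eq_zero]
          apply Finset.sum_congr rfl
          intro k _
          rw [show j + 1 + 1 + k = j + 1 + (k + 1) by ring]; ring
    · rintro ⟨g, rfl⟩
      rw [map_mul]
      have : phi 1 c (MvPowerSeries.X 1 - MvPowerSeries.C c * MvPowerSeries.X 0) = 0 := by
        have h := phi_coe 1 c (X 1 - C c * X 0)
        rw [coe_sub_RR, MvPolynomial.coe_mul, MvPolynomial.coe_X, MvPolynomial.coe_X,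
          MvPolynomial.coe_C] at h
        rw [h]
        simp
      rw [this, zero_mul]

lemma rank_line {l : RR} {φ : RR →ₐ[ℂ] PowerSeries ℂ} (hl : IsLine l φ) (A : RR) (e : ℕ)
    (w : PowerSeries ℂ) (hw : IsUnit w) (hA : φ A = PowerSeries.X ^ e * w) :
    Module.rank ℂ (RR ⧸ Ideal.span {A, l}) = (e : Cardinal) := by
  let ψ : RR →ₗ[ℂ] (Fin e → ℂ) :=
    LinearMap.pi fun k => (PowerSeries.coeff (k : ℕ)).comp φ.toLinearMap
  have hψ : ∀ f k, ψ f k = PowerSeries.coeff (k : ℕ) (φ f) := fun f k => rfl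
  have hsurj : Function.Surjective ψ := by
    intro v
    obtain ⟨f, hf⟩ := hl.surj (PowerSeries.mk fun n => if h : n < e then v ⟨n, h⟩ else 0)
    refine ⟨f, ?_⟩
    ext k
    rw [hψ, hf, PowerSeries.coeff_mk]
    simp
  have hker : (Ideal.span {A, l}).restrictScalars ℂ = LinearMap.ker ψ := by
    ext f
    rw [Submodule.restrictScalars_mem, LinearMap.mem_ker]
    have h1 : ψ f = 0 ↔ PowerSeries.X ^ e ∣ φ f := by
      rw [PowerSeries.X_pow_dvd_iff, funext_iff]
      constructor
      · intro h m hm; exact h ⟨m, hm⟩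
      · intro h k; exact h k k.2
    rw [h1, Ideal.mem_span_pair]
    constructor
    · rintro ⟨a, b, rfl⟩
      rw [map_add, map_mul, map_mul, (hl.ker l).2 dvd_rfl, hA]
      exact ⟨φ a * w, by ring⟩
    · rintro ⟨q, hq⟩
      obtain ⟨w', hw'⟩ := hw.exists_right_inv
      obtain ⟨a, ha⟩ := hl.surj (q * w')
      obtain ⟨b, hb⟩ := (hl.ker (f - a * A)).1 (by
        rw [map_sub, map_mul, ha, hA, hq]
        linear_combination (-PowerSeries.X ^ e * q) * hw')
      exact ⟨a, b, by linear_combination -hb⟩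
  have eqv := (Submodule.Quotient.restrictScalarsEquiv ℂ (Ideal.span {A, l})).symm.trans
    ((Submodule.quotEquivOfEq _ _ hker).trans (ψ.quotKerEquivOfSurjective hsurj))
  rw [eqv.rank_eq]
  simp

lemma rank_step {l : RR} {φ : RR →ₐ[ℂ] PowerSeries ℂ} (hl : IsLine l φ) (A G : RR)
    (hl0 : l ≠ 0) (hA : φ A ≠ 0) :
    Module.rank ℂ (RR ⧸ Ideal.span {A, l * G}) =
      Module.rank ℂ (RR ⧸ Ideal.span {A, l}) + Module.rank ℂ (RR ⧸ Ideal.span {A, G}) := by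
  have hIJ : Ideal.span {A, l * G} ≤ Ideal.span {A, l} := by
    rw [Ideal.span_le]
    rintro _ (rfl | rfl)
    · exact Ideal.subset_span (by simp)
    · exact Ideal.mul_mem_right _ _ (Ideal.subset_span (by simp))
  let α : (RR ⧸ Ideal.span {A, l * G}) →ₗ[ℂ] (RR ⧸ Ideal.span {A, l}) :=
    (Ideal.Quotient.factorₐ ℂ hIJ).toLinearMap
  have hα : ∀ p, α (Ideal.Quotient.mk _ p) = Ideal.Quotient.mk _ p := fun p => rfl
  have hK : Ideal.span {A, G} ≤
      Submodule.comap (LinearMap.mulLeft RR l) (Ideal.span {A, l * G}) := by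
    intro p hp
    rw [Ideal.mem_span_pair] at hp
    obtain ⟨a, b, rfl⟩ := hp
    rw [Submodule.mem_comap, LinearMap.mulLeft_apply, Ideal.mem_span_pair]
    exact ⟨l * a, b, by ring⟩
  let β : (RR ⧸ Ideal.span {A, G}) →ₗ[ℂ] (RR ⧸ Ideal.span {A, l * G}) :=
    (Submodule.mapQ _ _ (LinearMap.mulLeft RR l) hK).restrictScalars ℂ
  have hβ : ∀ p, β (Ideal.Quotient.mk _ p) = Ideal.Quotient.mk _ (l * p) := fun p => rfl
  have hαs : Function.Surjective α := by
    intro q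
    obtain ⟨p, rfl⟩ := Ideal.Quotient.mk_surjective q
    exact ⟨_, hα p⟩
  have hβi : Function.Injective β := by
    rw [injective_iff_map_eq_zero]
    intro q hq
    obtain ⟨p, rfl⟩ := Ideal.Quotient.mk_surjective q
    rw [hβ, Ideal.Quotient.eq_zero_iff_mem, Ideal.mem_span_pair] at hq
    obtain ⟨a, b, hab⟩ := hq
    have h1 : φ a * φ A = 0 := by
      rw [← map_mul]
      exact (hl.ker _).2 ⟨p - b * G, by linear_combination hab⟩
    obtain ⟨a', rfl⟩ := (hl.ker a).1 ((mul_eq_zero.1 h1).resolve_right hA)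
    rw [Ideal.Quotient.eq_zero_iff_mem, Ideal.mem_span_pair]
    exact ⟨a', b, mul_left_cancel₀ hl0 (by linear_combination hab)⟩
  have hr : LinearMap.range β = LinearMap.ker α := by
    ext q
    rw [LinearMap.mem_range, LinearMap.mem_ker]
    constructor
    · rintro ⟨q', rfl⟩
      obtain ⟨p, rfl⟩ := Ideal.Quotient.mk_surjective q'
      rw [hβ, hα, Ideal.Quotient.eq_zero_iff_mem]
      exact Ideal.mul_mem_right _ _ (Ideal.subset_span (by simp))
    · intro h
      obtain ⟨p, rfl⟩ := Ideal.Quotient.mk_surjective q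
      rw [hα, Ideal.Quotient.eq_zero_iff_mem, Ideal.mem_span_pair] at h
      obtain ⟨a, b, rfl⟩ := h
      refine ⟨Ideal.Quotient.mk _ b, ?_⟩
      rw [hβ, Ideal.Quotient.eq, Ideal.mem_span_pair]
      exact ⟨-a, 0, by ring⟩
  rw [← LinearMap.rank_range_add_rank_ker α, LinearMap.range_eq_top.2 hαs, rank_top, ← hr,
    (LinearEquiv.ofInjective β hβi).symm.rank_eq]

lemma line_ne_zero (c : ℂ) :
    (MvPowerSeries.X 1 - MvPowerSeries.C c * MvPowerSeries.X 0 : RR) ≠ 0 := by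
  intro h
  have := coeff_line_mul c 1 0 1
  rw [h] at this
  have h00 : EE 0 0 = 0 := by simp [EE]
  simp [h00] at this

lemma rank_lines (A : RR) (e : ℕ) (M : Multiset ℂ)
    (hA : ∀ c, ∃ w, IsUnit w ∧ phi 1 c A = PowerSeries.X ^ e * w) :
    Module.rank ℂ (RR ⧸ Ideal.span {A, (M.map fun c =>
      (MvPowerSeries.X 1 - MvPowerSeries.C c * MvPowerSeries.X 0 : RR)).prod}) =
      ((M.card * e : ℕ) : Cardinal) := by
  induction M using Multiset.induction_on with
  | empty =>
    have : Ideal.span {A, (1 : RR)} = ⊤ :=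
      (Ideal.eq_top_iff_one _).2 (Ideal.subset_span (by simp))
    simp only [Multiset.map_zero, Multiset.prod_zero, Multiset.card_zero, zero_mul, Nat.cast_zero]
    have : Subsingleton (RR ⧸ Ideal.span {A, (1 : RR)}) :=
      Ideal.Quotient.subsingleton_iff.2 this
    exact rank_subsingleton' ℂ (RR ⧸ Ideal.span {A, (1 : RR)})
  | cons c M ih =>
    obtain ⟨w, hw, h⟩ := hA c
    rw [Multiset.map_cons, Multiset.prod_cons, rank_step (isLine_c c) _ _ (line_ne_zero c),
      rank_line (isLine_c c) A e w hw h, ih, Multiset.card_cons]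
    · push_cast; ring
    · rw [h]
      exact mul_ne_zero (pow_ne_zero _ PowerSeries.X_ne_zero) hw.ne_zero

lemma pderiv_prod_RR {ι : Type*} [DecidableEq ι] (k : Fin 2) (t : Finset ι)
    (g : ι → MvPolynomial (Fin 2) ℂ) :
    pderiv k (∏ i ∈ t, g i) = ∑ i ∈ t, (∏ j ∈ t.erase i, g j) * pderiv k (g i) := by
  induction t using Finset.induction_on with
  | empty => simp
  | insert a t ha ih =>
    rw [Finset.prod_insert ha, Derivation.leibniz, ih, Finset.sum_insert ha,
      Finset.erase_insert ha, smul_eq_mul, smul_eq_mul, add_comm, Finset.mul_sum]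
    congr 1
    apply Finset.sum_congr rfl
    intro i hi
    have hia : a ≠ i := fun h => ha (h ▸ hi)
    rw [Finset.erase_insert_of_ne hia, Finset.prod_insert
      (fun h => ha (Finset.mem_of_mem_erase h))]
    ring

lemma deriv_factor (n : ℕ) (b : Fin (n + 1) → ℂ) :
    ∃ M : Multiset ℂ, M.card = n ∧
      pderiv 1 (∏ i, (X 1 - C (b i) * X 0) : MvPolynomial (Fin 2) ℂ) =
        C ((n : ℂ) + 1) * (M.map fun c => (X 1 - C c * X 0 : MvPolynomial (Fin 2) ℂ)).prod := by
  let P : Polynomial ℂ := ∏ i, (Polynomial.X - Polynomial.C (b i))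
  have hPm : P.Monic := Polynomial.monic_prod_of_monic _ _ fun i _ => Polynomial.monic_X_sub_C _
  have hPd : P.natDegree = n + 1 := by
    rw [Polynomial.natDegree_prod_of_monic _ _ fun i _ => Polynomial.monic_X_sub_C _]
    simp
  have hsp := IsAlgClosed.splits (Polynomial.derivative P)
  have hcard : (Polynomial.derivative P).roots.card = n := by
    rw [← hsp.natDegree_eq_card_roots, Polynomial.natDegree_derivative, hPd]; rfl
  have hroots := hsp.eq_prod_roots
  rw [Polynomial.leadingCoeff_derivative, hPm.leadingCoeff, one_mul, hPd] at hroots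
  have hder : Polynomial.derivative P =
      ∑ i, ∏ j ∈ Finset.univ.erase i, (Polynomial.X - Polynomial.C (b j)) := by
    simp [P, Polynomial.derivative_prod_finset]
  refine ⟨(Polynomial.derivative P).roots, hcard, ?_⟩
  generalize (Polynomial.derivative P).roots = M at hcard hroots
  have hev : ∀ t : ℂ, ∑ i, ∏ j ∈ Finset.univ.erase i, (t - b j) =
      ((n : ℂ) + 1) * (M.map fun c => t - c).prod := by
    intro t
    have := congrArg (Polynomial.eval t) (hder.symm.trans hroots)
    simpa [Polynomial.eval_finsetSum, Polynomial.eval_prod, Polynomial.eval_multiset_prod]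
      using this
  apply MvPolynomial.funext
  intro x
  rw [pderiv_prod_RR]
  have hl : MvPolynomial.eval x (∑ i, (∏ j ∈ Finset.univ.erase i, (X 1 - C (b j) * X 0)) *
      pderiv 1 (X 1 - C (b i) * X 0)) =
      ∑ i, ∏ j ∈ Finset.univ.erase i, (x 1 - b j * x 0) := by
    simp [pderiv_X, MvPolynomial.eval_prod, Pi.single_apply]
  have hr : MvPolynomial.eval x (C ((n : ℂ) + 1) * (M.map fun c => (X 1 - C c * X 0)).prod) =
      ((n : ℂ) + 1) * (M.map fun c => x 1 - c * x 0).prod := by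
    rw [map_mul, map_multiset_prod, Multiset.map_map]
    simp
  rw [hl, hr]
  have hec : ∀ i : Fin (n + 1), (Finset.univ.erase i).card = n := by
    intro i; simp [Finset.card_erase_of_mem]
  by_cases h0 : x 0 = 0
  · simp [h0, hcard, hec]
  · have h1 : ∀ c, x 1 - c * x 0 = x 0 * (x 1 / x 0 - c) := by
      intro c; field_simp
    simp only [h1, Finset.prod_mul_distrib, Finset.prod_const, hec, Multiset.prod_map_mul,
      Multiset.map_const', Multiset.prod_replicate, hcard, ← Finset.mul_sum, hev]
    ring

lemma pderiv_zero_f (m : ℕ) (b : Fin (m + 2) → ℂ) (s : ℂ) :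
    pderiv 0 (C s * (X 0) ^ (m + 2) + X 0 * ∏ i, (X 1 - C (b i) * X 0)) =
      (C (s * (m + 2)) * X 0 ^ (m + 1) + (∏ i, (X 1 - C (b i) * X 0)) +
        X 0 * ∑ i, (∏ j ∈ Finset.univ.erase i, (X 1 - C (b j) * X 0)) * C (- b i) :
        MvPolynomial (Fin 2) ℂ) := by
  rw [map_add, Derivation.leibniz, Derivation.leibniz, pderiv_prod_RR]
  have : ∀ i, pderiv (0 : Fin 2) (X 1 - C (b i) * X 0 : MvPolynomial (Fin 2) ℂ) = C (- b i) := by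
    intro i; simp [pderiv_X, Pi.single_apply]
  simp only [this]
  have h2 : (C 2 : MvPolynomial (Fin 2) ℂ) = 2 := map_ofNat C 2
  simp [Derivation.leibniz_pow, h2]
  ring

lemma stmt_aux (m : ℕ) (b : Fin (m + 2) → ℂ) (s : ℂ) (hs : s ≠ 0)
    (f : MvPolynomial (Fin 2) ℂ)
    (hf : f = C s * (X 0) ^ (m + 2) + X 0 * ∏ i, (X 1 - C (b i) * X 0)) :
    Module.rank ℂ
      (MvPowerSeries (Fin 2) ℂ ⧸
        Ideal.span {(↑(pderiv 0 f) : MvPowerSeries (Fin 2) ℂ), ↑(pderiv 1 f)})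
      = (((m + 2) * (m + 1) + 1 : ℕ) : Cardinal) := by
  have hA := pderiv_zero_f m b s
  rw [← hf] at hA
  obtain ⟨M, hM, hfac⟩ := deriv_factor (m + 1) b
  have hB : pderiv 1 f = C (((m + 1 : ℕ) : ℂ) + 1) *
      (X 0 * (M.map fun c => (X 1 - C c * X 0 : MvPolynomial (Fin 2) ℂ)).prod) := by
    rw [hf, map_add, Derivation.leibniz, Derivation.leibniz, hfac]
    simp [pderiv_X, Pi.single_apply, Derivation.leibniz_pow]
    ring
  have hprod : (((M.map fun c => (X 1 - C c * X 0 : MvPolynomial (Fin 2) ℂ)).prod :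
      MvPolynomial (Fin 2) ℂ) : RR) = (M.map fun c =>
      (MvPowerSeries.X 1 - MvPowerSeries.C c * MvPowerSeries.X 0 : RR)).prod := by
    change MvPolynomial.coeToMvPowerSeries.ringHom _ = _
    rw [map_multiset_prod, Multiset.map_map]
    congr 1
    apply Multiset.map_congr rfl
    intro c _
    change ((X 1 - C c * X 0 : MvPolynomial (Fin 2) ℂ) : RR) = _
    rw [coe_sub_RR, MvPolynomial.coe_mul, MvPolynomial.coe_X, MvPolynomial.coe_X,
      MvPolynomial.coe_C]
  have hn : (((m + 1 : ℕ) : ℂ) + 1) ≠ 0 := by exact_mod_cast Nat.succ_ne_zero (m + 1)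
  have hspan : Ideal.span {(↑(pderiv 0 f) : RR), (↑(pderiv 1 f) : RR)} =
      Ideal.span {(↑(pderiv 0 f) : RR), MvPowerSeries.X 0 * (M.map fun c =>
      (MvPowerSeries.X 1 - MvPowerSeries.C c * MvPowerSeries.X 0 : RR)).prod} := by
    have hu : IsUnit (MvPowerSeries.C (((m + 1 : ℕ) : ℂ) + 1) : RR) :=
      (IsUnit.mk0 _ hn).map MvPowerSeries.C
    rw [hB, MvPolynomial.coe_mul, MvPolynomial.coe_mul, hprod, MvPolynomial.coe_C,
      MvPolynomial.coe_X, Ideal.span_insert, Ideal.span_singleton_mul_left_unit hu,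
      ← Ideal.span_insert]
  have hAx : phi 0 1 (pderiv 0 f : RR) = PowerSeries.X ^ (m + 2) * 1 := by
    rw [phi_coe, hA]
    simp
  have hAc : ∀ c, ∃ w, IsUnit w ∧ phi 1 c (pderiv 0 f : RR) = PowerSeries.X ^ (m + 1) * w := by
    intro c
    refine ⟨PowerSeries.C (s * (m + 2)) + PowerSeries.X *
      (PowerSeries.C (∏ i, (c - b i)) +
        ∑ i, PowerSeries.C (∏ j ∈ Finset.univ.erase i, (c - b j)) * PowerSeries.C (- b i)),
        ?_, ?_⟩
    · rw [PowerSeries.isUnit_iff_constantCoeff]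
      have h2 : ((m : ℂ) + 2) ≠ 0 := by exact_mod_cast Nat.succ_ne_zero (m + 1)
      simp [hs, h2]
    · have hec : ∀ i : Fin (m + 2), (Finset.univ.erase i).card = m + 1 := by
        intro i; simp [Finset.card_erase_of_mem]
      have hC : ∀ r : ℂ, algebraMap ℂ (PowerSeries ℂ) r = PowerSeries.C r := fun r => rfl
      have hlin : ∀ i, PowerSeries.C c * PowerSeries.X - PowerSeries.C (b i) * PowerSeries.X =
        PowerSeries.C (c - b i) * PowerSeries.X := by intro i; rw [map_sub]; ring
      rw [phi_coe, hA]
      simp only [map_add, map_mul, map_prod, map_sum, map_sub, map_pow, aeval_X, aeval_C,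
        Matrix.cons_val_zero, Matrix.cons_val_one, hC, map_one, one_mul]
      simp only [hlin, Finset.prod_mul_distrib, Finset.prod_const, hec, Finset.card_univ,
        Fintype.card_fin, map_sub]
      have hsum : ∑ i, (∏ j ∈ Finset.univ.erase i, (PowerSeries.C c - PowerSeries.C (b j))) *
          PowerSeries.X ^ (m + 1) * PowerSeries.C (- b i) = PowerSeries.X ^ (m + 1) *
          ∑ i, (∏ j ∈ Finset.univ.erase i, (PowerSeries.C c - PowerSeries.C (b j))) *
            PowerSeries.C (- b i) := by
        rw [Finset.mul_sum]
        apply Finset.sum_congr rfl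
        intro i _
        ring
      rw [hsum]
      ring
  rw [hspan, rank_step isLine_x, rank_line isLine_x _ (m + 2) 1 isUnit_one hAx,
    rank_lines _ (m + 1) M hAc, hM]
  · push_cast; ring
  · intro h
    have := (MvPowerSeries.coeff_X (R := ℂ) (Finsupp.single (0 : Fin 2) 1) (0 : Fin 2))
    rw [h] at this
    simp at this
  · rw [hAx, mul_one]
    exact pow_ne_zero _ PowerSeries.X_ne_zero

end Milnor

/-- Let `f₀ = x·∏_{i}(y - bᵢx)` be a product of `d` pairwise non-proportional linear
forms (`d ≥ 3`, the `bᵢ` pairwise distinct) and, for `s ≠ 0`, `f_s = s·x^(d-1) + f₀`.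
Then the Milnor number of `f_s` at `0`, i.e. the dimension of
`ℂ[[x,y]]/(∂f_s/∂x, ∂f_s/∂y)`, equals `(d-1)(d-2) + 1`. -/
theorem stmt_17 (d : ℕ) (hd : 3 ≤ d) (b : Fin (d - 1) → ℂ) (hb : Function.Injective b)
    (s : ℂ) (hs : s ≠ 0)
    (f : MvPolynomial (Fin 2) ℂ)
    (hf : f = C s * (X 0) ^ (d - 1) + X 0 * ∏ i, (X 1 - C (b i) * X 0)) :
    Module.finrank ℂ
      (MvPowerSeries (Fin 2) ℂ ⧸
        Ideal.span {(↑(pderiv 0 f) : MvPowerSeries (Fin 2) ℂ), ↑(pderiv 1 f)})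
      = (d - 1) * (d - 2) + 1 := by
  obtain ⟨m, rfl⟩ : ∃ m, d = m + 3 := ⟨d - 3, by omega⟩
  exact Module.finrank_eq_of_rank_eq (stmt_aux m b s hs f hf)
end

section
/- Let k ≥ 1 and s ≠ 0, and let f(x,y) = x^{2k} + (y² + sx)^k. Then the intersection multiplicity at the origin of ∂f/∂x = 2k·x^{2k-1} + k·s·(y²+sx)^{k-1} and ∂f/∂y = 2k·y·(y²+sx)^{k-1} equals 4k² - 5k + 1. -/
theorem lemA {R : Type*} [CommRing R] [IsDomain R] [Algebra ℂ R] (g a b : R) (hb : b ≠ 0)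
    (hreg : ∀ p, b ∣ g * p → b ∣ p) :
    Module.rank ℂ (R ⧸ Ideal.span {g, a * b}) =
      Module.rank ℂ (R ⧸ Ideal.span {g, b}) + Module.rank ℂ (R ⧸ Ideal.span {g, a}) := by
  have h1 : Ideal.span {g, a * b} ≤ Ideal.span {g, b} := by
    rw [Ideal.span_le]
    rintro x (rfl | rfl)
    · exact Ideal.subset_span (by simp)
    · exact Ideal.mul_mem_left _ _ (Ideal.subset_span (by simp))
  let π : (R ⧸ Ideal.span {g, a * b}) →ₗ[ℂ] (R ⧸ Ideal.span {g, b}) :=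
    (Ideal.Quotient.factorₐ ℂ h1).toLinearMap
  have hπ : Function.Surjective π := Ideal.Quotient.factor_surjective h1
  rw [← LinearMap.rank_range_add_rank_ker π, rank_range_of_surjective π hπ]
  congr 1
  let μ₀ : R →ₗ[ℂ] (R ⧸ Ideal.span {g, a * b}) :=
    (Ideal.Quotient.mkₐ ℂ (Ideal.span {g, a * b})).toLinearMap ∘ₗ LinearMap.mulLeft ℂ b
  have hμ₀ : ∀ r, μ₀ r = Ideal.Quotient.mk _ (b * r) := fun r => rfl
  have hker : LinearMap.ker μ₀ = (Ideal.span {g, a}).restrictScalars ℂ := by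
    ext r
    rw [LinearMap.mem_ker, hμ₀, Ideal.Quotient.eq_zero_iff_mem, Submodule.restrictScalars_mem,
      Ideal.mem_span_pair, Ideal.mem_span_pair]
    constructor
    · rintro ⟨p, q, h⟩
      obtain ⟨p', rfl⟩ := hreg p ⟨r - a * q, by linear_combination h⟩
      exact ⟨p', q, mul_left_cancel₀ hb (by linear_combination h)⟩
    · rintro ⟨p, q, rfl⟩
      exact ⟨b * p, q, by ring⟩
  have hrange : LinearMap.range μ₀ = LinearMap.ker π := by
    ext z
    obtain ⟨z, rfl⟩ := Ideal.Quotient.mk_surjective z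
    have : π (Ideal.Quotient.mk _ z) = Ideal.Quotient.mk _ z := rfl
    rw [LinearMap.mem_ker, this, Ideal.Quotient.eq_zero_iff_mem, Ideal.mem_span_pair]
    constructor
    · rintro ⟨r, hr⟩
      rw [hμ₀, Ideal.Quotient.eq, Ideal.mem_span_pair] at hr
      obtain ⟨p, q, h⟩ := hr
      exact ⟨-p, r - q * a, by linear_combination -h⟩
    · rintro ⟨p, q, rfl⟩
      refine ⟨q, ?_⟩
      rw [hμ₀, Ideal.Quotient.eq, Ideal.mem_span_pair]
      exact ⟨-p, 0, by ring⟩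
  rw [← hrange, ← μ₀.quotKerEquivRange.rank_eq, hker]
  exact (Submodule.Quotient.restrictScalarsEquiv ℂ (Ideal.span {g, a})).rank_eq

theorem lemB {R : Type*} [CommRing R] [IsDomain R] [Algebra ℂ R] (g b : R) (hb : b ≠ 0)
    (hreg : ∀ p, b ∣ g * p → b ∣ p) (n : ℕ) :
    Module.rank ℂ (R ⧸ Ideal.span {g, b ^ n}) =
      n * Module.rank ℂ (R ⧸ Ideal.span {g, b}) := by
  induction n with
  | zero =>
    have : Ideal.span {g, b ^ 0} = ⊤ := by
      rw [Ideal.eq_top_iff_one]; exact Ideal.subset_span (by simp)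
    rw [this]
    have : Subsingleton (R ⧸ (⊤ : Ideal R)) := Ideal.Quotient.subsingleton_iff.2 rfl
    simp
  | succ n ih =>
    rw [pow_succ, lemA g _ b hb hreg, ih]
    push_cast
    ring

theorem span_pair_eq {R : Type*} [CommRing R] {a b c d : R}
    (h1 : ∃ p q, p * c + q * d = a) (h2 : ∃ p q, p * c + q * d = b)
    (h3 : ∃ p q, p * a + q * b = c) (h4 : ∃ p q, p * a + q * b = d) :
    Ideal.span {a, b} = Ideal.span {c, d} := by
  apply le_antisymm <;> rw [Ideal.span_le] <;> rintro x (rfl | rfl) <;>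
    rw [SetLike.mem_coe, Ideal.mem_span_pair] <;> assumption

theorem X_dvd_iff_order (i : Fin 2) (f : MvPowerSeries (Fin 2) ℂ) :
    MvPowerSeries.X i ∣ f ↔ f.weightedOrder (Pi.single i 1) ≠ 0 := by
  have hw : ∀ d : Fin 2 →₀ ℕ, Finsupp.weight (Pi.single i 1) d = d i := by
    intro d
    rw [Finsupp.weight_apply, Finsupp.sum_fintype _ _ (by simp)]
    simp [Pi.single_apply]
  have := MvPowerSeries.weightedOrder_eq_nat (f := f) (Pi.single i 1) (n := 0)
  simp only [hw] at this
  rw [Nat.cast_zero] at this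
  rw [MvPowerSeries.X_dvd_iff, Ne, this]
  constructor
  · rintro h ⟨⟨d, hd, hd0⟩, -⟩
    exact hd (h d hd0)
  · intro h m hm
    by_contra hc
    exact h ⟨⟨m, hc, hm⟩, by simp⟩

theorem X_isPrime (i : Fin 2) : Prime (MvPowerSeries.X i : MvPowerSeries (Fin 2) ℂ) := by
  refine ⟨?_, ?_, ?_⟩
  · intro h
    have := congrArg (MvPowerSeries.coeff (Finsupp.single i 1)) h
    simp [MvPowerSeries.coeff_X] at this
  · intro h
    rw [MvPowerSeries.isUnit_iff_constantCoeff] at h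
    simp at h
  · intro a b h
    rw [X_dvd_iff_order, MvPowerSeries.weightedOrder_mul] at h
    rw [X_dvd_iff_order, X_dvd_iff_order]
    by_contra hc
    push Not at hc
    exact h (by rw [hc.1, hc.2, add_zero])

open MvPowerSeries in
theorem lemC : Module.rank ℂ (MvPowerSeries (Fin 2) ℂ ⧸
    Ideal.span {(X 0 : MvPowerSeries (Fin 2) ℂ), X 1}) = 1 := by
  have hk : LinearMap.ker (coeff (R := ℂ) (0 : Fin 2 →₀ ℕ)) =
      (Ideal.span {(X 0 : MvPowerSeries (Fin 2) ℂ), X 1}).restrictScalars ℂ := by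
    apply le_antisymm
    · intro f hf
      rw [LinearMap.mem_ker] at hf
      rw [Submodule.restrictScalars_mem, Ideal.mem_span_pair]
      let f0 : MvPowerSeries (Fin 2) ℂ := fun m => if m 0 = 0 then coeff m f else 0
      have hf0 : ∀ m, coeff m f0 = if m 0 = 0 then coeff m f else 0 := fun m => rfl
      obtain ⟨p, hp⟩ : X 0 ∣ f - f0 := by
        rw [X_dvd_iff]
        intro m hm
        rw [map_sub, hf0, if_pos hm, sub_self]
      obtain ⟨q, hq⟩ : X 1 ∣ f0 := by
        rw [X_dvd_iff]
        intro m hm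
        rw [hf0]
        split_ifs with h
        · have : m = 0 := by
            ext i; fin_cases i <;> simpa
          rw [this, hf]
        · rfl
      exact ⟨p, q, by linear_combination -hp - hq⟩
    · intro f hf
      rw [Submodule.restrictScalars_mem, Ideal.mem_span_pair] at hf
      obtain ⟨p, q, rfl⟩ := hf
      rw [LinearMap.mem_ker, coeff_zero_eq_constantCoeff]
      simp
  have hs : Function.Surjective (coeff (R := ℂ) (0 : Fin 2 →₀ ℕ)) := fun c =>
    ⟨C c, by simp⟩
  have e := (Submodule.Quotient.restrictScalarsEquiv ℂ
    (Ideal.span {(X 0 : MvPowerSeries (Fin 2) ℂ), X 1})).symm ≪≫ₗ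
    Submodule.quotEquivOfEq _ _ hk.symm ≪≫ₗ LinearMap.quotKerEquivOfSurjective _ hs
  rw [e.rank_eq, Module.rank_self]

theorem X_not_dvd (i j : Fin 2) (hij : i ≠ j) :
    ¬ (MvPowerSeries.X i : MvPowerSeries (Fin 2) ℂ) ∣ MvPowerSeries.X j := by
  rw [MvPowerSeries.X_dvd_iff]
  intro h
  have := h (Finsupp.single j 1) (by simp [hij])
  simp [MvPowerSeries.coeff_X] at this

open MvPowerSeries in
theorem main_rank (m : ℕ) (hm : 1 ≤ m) (s c : ℂ) (hs : s ≠ 0) (hc : c ≠ 0)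
    (u g : MvPowerSeries (Fin 2) ℂ) (hu : u = X 1 ^ 2 + C s * X 0)
    (hg : g = C (2 * c) * X 0 ^ (2 * m + 1) + C (c * s) * u ^ m) :
    Module.rank ℂ (MvPowerSeries (Fin 2) ℂ ⧸
      Ideal.span {g, C (2 * c) * X 1 * u ^ m}) = ((m + m * ((2 * m + 1) * 2) : ℕ) : Cardinal) := by
  have : IsDomain (MvPowerSeries (Fin 2) ℂ) := NoZeroDivisors.to_isDomain _
  have hcc : (C (2 * c) : MvPowerSeries (Fin 2) ℂ) * C (2 * c)⁻¹ = 1 := by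
    rw [← map_mul, mul_inv_cancel₀ (by simpa using hc), map_one]
  have hss : (C s : MvPowerSeries (Fin 2) ℂ) * C s⁻¹ = 1 := by
    rw [← map_mul, mul_inv_cancel₀ hs, map_one]
  have px := X_isPrime 0
  have py := X_isPrime 1
  have hprime : ∀ b a : MvPowerSeries (Fin 2) ℂ, Prime b → ¬ b ∣ a → ∀ p, b ∣ a * p → b ∣ p :=
    fun b a hb ha p h => (hb.dvd_or_dvd h).resolve_left ha
  obtain ⟨q, hq⟩ : (X 1 : MvPowerSeries (Fin 2) ℂ) ^ 2 ∣ u ^ m - (C s * X 0) ^ m := by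
    have := sub_dvd_pow_sub_pow u (C s * X 0) m
    rwa [hu, add_sub_cancel_right, ← hu] at this
  let v : MvPowerSeries (Fin 2) ℂ := C (2 * c) * X 0 ^ (m + 1) + C (c * s) * C s ^ m
  have hv : IsUnit v := by
    rw [isUnit_iff_constantCoeff]
    simp [v, hc, hs]
  obtain ⟨w, hw⟩ := hv.exists_right_inv
  have hgy : g = X 0 ^ m * v + X 1 * (C (c * s) * (X 1 * q)) := by
    rw [mul_pow] at hq
    simp only [v]
    rw [hg]
    linear_combination C (c * s) * hq
  have hyg : ¬ X 1 ∣ g := by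
    intro h
    rw [hgy, dvd_add_left (dvd_mul_right _ _), hv.dvd_mul_right] at h
    exact X_not_dvd 1 0 (by decide) (py.dvd_of_dvd_pow h)
  have e1 : Ideal.span {g, C (2 * c) * X 1 * u ^ m} = Ideal.span {g, u ^ m * X 1} :=
    span_pair_eq ⟨1, 0, by ring⟩ ⟨0, C (2 * c), by ring⟩ ⟨1, 0, by ring⟩
      ⟨0, C (2 * c)⁻¹, by linear_combination (u ^ m * X 1) * hcc⟩
  have e2 : Ideal.span {g, X 1} = Ideal.span {X 1, X 0 ^ m} :=
    span_pair_eq ⟨C (c * s) * (X 1 * q), v, by rw [hgy]; ring⟩ ⟨1, 0, by ring⟩ ⟨0, 1, by ring⟩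
      ⟨w, - w * (C (c * s) * (X 1 * q)), by rw [hgy]; linear_combination (X 0 ^ m) * hw⟩
  have r2 : Module.rank ℂ (MvPowerSeries (Fin 2) ℂ ⧸ Ideal.span {g, X 1}) = m := by
    rw [e2, lemB _ _ px.ne_zero (hprime _ _ px (X_not_dvd 0 1 (by decide))), Set.pair_comm, lemC,
      mul_one]
  have hxu : ¬ X 0 ∣ u := by
    rw [hu, dvd_add_left (dvd_mul_left _ _)]
    exact fun h => X_not_dvd 0 1 (by decide) (px.dvd_of_dvd_pow h)
  have hu0 : u ≠ 0 := by
    rintro h; rw [h] at hxu; exact hxu (dvd_zero _)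
  have hux : ∀ p, u ∣ X 0 * p → u ∣ p := by
    rintro p ⟨r, hr⟩
    obtain ⟨r', rfl⟩ := hprime _ _ px hxu r ⟨p, hr.symm⟩
    exact ⟨r', mul_left_cancel₀ px.ne_zero (by linear_combination hr)⟩
  have huxn : ∀ n p, u ∣ X 0 ^ n * p → u ∣ p := by
    intro n
    induction n with
    | zero => intro p h; simpa using h
    | succ n ih => intro p h; exact ih p (hux _ (by rwa [← mul_assoc, ← pow_succ']))
  obtain ⟨t, ht⟩ : u ∣ u ^ m := dvd_pow_self u (by omega)
  have hgu : g = C (2 * c) * X 0 ^ (2 * m + 1) + u * (C (c * s) * t) := by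
    rw [hg]; linear_combination C (c * s) * ht
  have hureg : ∀ p, u ∣ g * p → u ∣ p := by
    rintro p ⟨r, hr⟩
    apply huxn (2 * m + 1)
    refine ⟨C (2 * c)⁻¹ * (r - C (c * s) * t * p), ?_⟩
    rw [hgu] at hr
    linear_combination C (2 * c)⁻¹ * hr - X 0 ^ (2 * m + 1) * p * hcc
  have e3 : Ideal.span {g, u} = Ideal.span {u, X 0 ^ (2 * m + 1)} :=
    span_pair_eq ⟨C (c * s) * t, C (2 * c), by rw [hgu]; ring⟩ ⟨1, 0, by ring⟩ ⟨0, 1, by ring⟩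
      ⟨C (2 * c)⁻¹, - C (2 * c)⁻¹ * (C (c * s) * t), by
        rw [hgu]; linear_combination (X 0 ^ (2 * m + 1)) * hcc⟩
  have e4 : Ideal.span {u, X 0} = Ideal.span {X 0, X 1 ^ 2} :=
    span_pair_eq ⟨C s, 1, by rw [hu]; ring⟩ ⟨1, 0, by ring⟩ ⟨0, 1, by ring⟩
      ⟨1, - C s, by rw [hu]; ring⟩
  rw [e1, lemA _ _ _ py.ne_zero (hprime _ _ py hyg), r2, lemB _ _ hu0 hureg, e3,
    lemB _ _ px.ne_zero (hprime _ _ px hxu), e4,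
    lemB _ _ py.ne_zero (hprime _ _ py (X_not_dvd 1 0 (by decide))), lemC]
  push_cast
  ring

open MvPolynomial

/-- For `k ≥ 1`, `s ≠ 0` and `f = x^(2k) + (y² + sx)^k`, the intersection multiplicity
at the origin of `∂f/∂x = 2k·x^(2k-1) + ks(y²+sx)^(k-1)` and
`∂f/∂y = 2k·y·(y²+sx)^(k-1)`, i.e. `dim_ℂ ℂ[[x,y]]/(∂f/∂x, ∂f/∂y)`, equals
`4k² - 5k + 1`. -/
theorem stmt_18 (k : ℕ) (hk : 1 ≤ k) (s : ℂ) (hs : s ≠ 0)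
    (g h : MvPolynomial (Fin 2) ℂ)
    (hg : g = C (2 * (k : ℂ)) * (X 0) ^ (2 * k - 1)
        + C ((k : ℂ) * s) * ((X 1) ^ 2 + C s * X 0) ^ (k - 1))
    (hh : h = C (2 * (k : ℂ)) * X 1 * ((X 1) ^ 2 + C s * X 0) ^ (k - 1)) :
    (Module.finrank ℂ
        (MvPowerSeries (Fin 2) ℂ ⧸
          Ideal.span {(↑g : MvPowerSeries (Fin 2) ℂ), ↑h}) : ℤ)
      = 4 * (k : ℤ) ^ 2 - 5 * k + 1 := by
  obtain ⟨m, rfl⟩ : ∃ m, k = m + 1 := ⟨k - 1, by omega⟩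
  have hc : ((m + 1 : ℕ) : ℂ) ≠ 0 := Nat.cast_ne_zero.2 (by omega)
  have e1 : 2 * (m + 1) - 1 = 2 * m + 1 := by omega
  have e2 : m + 1 - 1 = m := by omega
  rw [e1, e2] at hg
  rw [e2] at hh
  generalize hcdef : ((m + 1 : ℕ) : ℂ) = c at *
  rcases Nat.eq_zero_or_pos m with rfl | hm
  · have hu : IsUnit (g : MvPowerSeries (Fin 2) ℂ) := by
      rw [MvPowerSeries.isUnit_iff_constantCoeff, hg]
      simp [hc, hs]
    have ht : Ideal.span {(g : MvPowerSeries (Fin 2) ℂ), ↑h} = ⊤ :=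
      Ideal.eq_top_of_isUnit_mem _ (Ideal.subset_span (by simp)) hu
    rw [ht]
    have : Subsingleton (MvPowerSeries (Fin 2) ℂ ⧸ (⊤ : Ideal (MvPowerSeries (Fin 2) ℂ))) :=
      Ideal.Quotient.subsingleton_iff.2 rfl
    rw [Module.finrank_zero_of_subsingleton]
    norm_num
  · have key := main_rank m hm s c hs hc _ _ rfl rfl
    have hg' : (g : MvPowerSeries (Fin 2) ℂ) = MvPowerSeries.C (2 * c) *
        MvPowerSeries.X 0 ^ (2 * m + 1) + MvPowerSeries.C (c * s) *
        (MvPowerSeries.X 1 ^ 2 + MvPowerSeries.C s * MvPowerSeries.X 0) ^ m := by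
      rw [hg]
      simp only [coe_add, coe_mul, coe_pow, coe_C, coe_X]
    have hh' : (h : MvPowerSeries (Fin 2) ℂ) = MvPowerSeries.C (2 * c) * MvPowerSeries.X 1 *
        (MvPowerSeries.X 1 ^ 2 + MvPowerSeries.C s * MvPowerSeries.X 0) ^ m := by
      rw [hh]
      simp only [coe_add, coe_mul, coe_pow, coe_C, coe_X]
    rw [hg', hh', Module.finrank_eq_of_rank_eq key]
    push_cast
    ring
end
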